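/- arXiv:2408.04542 — 7 statements merged into one kernel-verified Lean document; each statement's English description precedes it below -/
import Mathlib

section
/- For every θ ≥ 0 there exist δ₀ > 0 and c₁ > 0 such that for every h ∈ ℝ with |h| ≤ θ and every u ∈ ℝ with |u| ≤ δ₀, one has | ∫_ℝ e^{i u s} ν_h(ds) | ≤ e^{−c₁ u²}. -/
open MeasureTheory Filter Topology
open scoped ENNReal NNReal

noncomputable section

/-- The tilted probability measure `ν_h` on `ℝ` with density
`e^{-F(s) + h s} / ∫ e^{-F(r) + h r} dr` with respect to Lebesgue measure. -/
def nuTilt (F : ℝ → ℝ) (h : ℝ) : Measure ℝ :=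
  (ENNReal.ofReal (∫ r : ℝ, Real.exp (-F r + h * r)))⁻¹ •
    (volume.withDensity fun s => ENNReal.ofReal (Real.exp (-F s + h * s)))

lemma aux_cos {x : ℝ} (hx : |x| ≤ Real.pi + 1) : x ^ 2 / 25 ≤ 1 - Real.cos x := by
  have h3 := Real.pi_gt_three
  have h4 := Real.pi_lt_four
  rcases le_total |x| Real.pi with h | h
  · have h1 := Real.cos_le_one_sub_mul_cos_sq h
    have h2 : (1 : ℝ) / 25 ≤ 2 / Real.pi ^ 2 := by
      rw [div_le_div_iff₀ (by norm_num) (by positivity)]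
      nlinarith
    have h5 := mul_le_mul_of_nonneg_right h2 (sq_nonneg x)
    linarith
  · have h1 : Real.cos |x| ≤ 0 :=
      Real.cos_nonpos_of_pi_div_two_le_of_le (by linarith) (by linarith)
    rw [Real.cos_abs] at h1
    have h2 : x ^ 2 ≤ 25 := by
      rw [← sq_abs]
      nlinarith [abs_nonneg x]
    linarith

lemma aux_norm (w : ℝ → ℝ) (hw : Integrable w) (u : ℝ) :
    ∃ a : ℝ, |a| ≤ Real.pi ∧
      ‖∫ s : ℝ, (w s : ℂ) * Complex.exp (Complex.I * u * s)‖
        = ∫ s : ℝ, w s * Real.cos (u * s - a) := by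
  set P := ∫ s : ℝ, (w s : ℂ) * Complex.exp (Complex.I * u * s) with hP
  refine ⟨P.arg, Complex.abs_arg_le_pi P, ?_⟩
  have hint : Integrable (fun s : ℝ => (w s : ℂ) * Complex.exp (Complex.I * u * s)) := by
    refine (hw.ofReal (𝕜 := ℂ)).mul_bdd (c := 1) (by fun_prop) ?_
    refine Filter.Eventually.of_forall fun s => ?_
    have : Complex.I * u * s = ((u * s : ℝ) : ℂ) * Complex.I := by push_cast; ring
    rw [this, Complex.norm_exp_ofReal_mul_I]
  have h1 : (‖P‖ : ℂ) = Complex.exp (-(P.arg * Complex.I)) * P := by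
    conv_rhs => rw [← Complex.norm_mul_exp_arg_mul_I P]
    rw [mul_left_comm, Complex.norm_mul_exp_arg_mul_I, ← Complex.exp_add]
    simp
  have h2 : ‖P‖ = (Complex.exp (-(P.arg * Complex.I)) * P).re := by
    rw [← h1, Complex.ofReal_re]
  rw [h2, hP, ← integral_const_mul, ← hP]
  have h3 := Complex.reCLM.integral_comp_comm
    (hint.const_mul (Complex.exp (-(P.arg * Complex.I))))
  simp only [Complex.reCLM_apply] at h3
  rw [← h3]
  refine integral_congr_ae (Filter.Eventually.of_forall fun s => ?_)
  show (_ : ℂ).re = _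
  rw [mul_left_comm, ← Complex.exp_add, Complex.re_ofReal_mul]
  have : -(P.arg * Complex.I) + Complex.I * u * s = ((u * s - P.arg : ℝ) : ℂ) * Complex.I := by
    push_cast; ring
  rw [this, Complex.exp_ofReal_mul_I_re]

lemma aux_var (g : ℝ → ℝ) (hg : ∀ s, 0 < g s) (hi : Integrable g) :
    ∃ V : ℝ, 0 < V ∧ ∀ u a : ℝ, u ^ 2 * V ≤ ∫ s in Set.Icc (-1 : ℝ) 1, (u * s - a) ^ 2 * g s := by
  have hb : ∀ f : ℝ → ℝ, Continuous f → IntegrableOn (fun s => f s * g s) (Set.Icc (-1 : ℝ) 1) :=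
    fun f hf => hi.integrableOn.continuousOn_mul hf.continuousOn isCompact_Icc
  set m0 := ∫ s in Set.Icc (-1 : ℝ) 1, g s with hm0
  have hm0p : 0 < m0 := by
    rw [hm0, integral_pos_iff_support_of_nonneg (fun s => (hg s).le) hi.integrableOn]
    have : Function.support g = Set.univ := by
      ext s; simp [(hg s).ne']
    rw [this]; simp
  set m1 := ∫ s in Set.Icc (-1 : ℝ) 1, s * g s with hm1
  set m := m1 / m0 with hm
  have hmm : m * m0 = m1 := by rw [hm]; field_simp
  refine ⟨∫ s in Set.Icc (-1 : ℝ) 1, (s - m) ^ 2 * g s, ?_, fun u a => ?_⟩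
  · rw [integral_pos_iff_support_of_nonneg (fun s => mul_nonneg (sq_nonneg _) (hg s).le)
      (hb (fun s => (s - m) ^ 2) (by fun_prop))]
    have : Function.support (fun s => (s - m) ^ 2 * g s) = {m}ᶜ := by
      ext s; simp [(hg s).ne', sub_eq_zero]
    rw [this, measure_compl (measurableSet_singleton m) (by simp)]
    simp
  · have e : ∀ s, (u * s - a) ^ 2 * g s = u ^ 2 * ((s - m) ^ 2 * g s)
        + ((2 * u * (u * m - a)) * (s * g s) +
          ((u * m - a) ^ 2 - 2 * u * (u * m - a) * m) * g s) := fun s => by ring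
    simp_rw [e]
    have i1 := hb (fun s => (s - m) ^ 2) (by fun_prop)
    have i2 := hb (fun s => s) (by fun_prop)
    have i3 : IntegrableOn (fun s => (2 * u * (u * m - a)) * (s * g s) +
          ((u * m - a) ^ 2 - 2 * u * (u * m - a) * m) * g s) (Set.Icc (-1 : ℝ) 1) :=
      (i2.const_mul _).add (hi.integrableOn.const_mul _)
    rw [integral_add (i1.const_mul _) i3,
      integral_add (i2.const_mul _) (hi.integrableOn.const_mul _),
      integral_const_mul, integral_const_mul, integral_const_mul, ← hm0, ← hm1, ← hmm]
    nlinarith [mul_nonneg (sq_nonneg (u * m - a)) hm0p.le]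

/-- Soft-frequency bound for the tilted single-spin measures: for every
`θ ≥ 0` there are `δ₀ > 0` and `c₁ > 0` such that for all `|h| ≤ θ` and `|u| ≤ δ₀`,
`|∫ e^{ius} ν_h(ds)| ≤ e^{-c₁ u²}`. -/
theorem tilted_soft_frequency_bound
    (A c : ℝ) (hA : 0 < A) (F : ℝ → ℝ) (hFmeas : Measurable F)
    (hF : ∀ s : ℝ, A * s ^ 2 - c ≤ F s) :
    ∀ θ : ℝ, 0 ≤ θ →
      ∃ δ₀ : ℝ, 0 < δ₀ ∧ ∃ c₁ : ℝ, 0 < c₁ ∧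
        ∀ h : ℝ, |h| ≤ θ → ∀ u : ℝ, |u| ≤ δ₀ →
          ‖∫ s, Complex.exp (Complex.I * u * s) ∂(nuTilt F h)‖ ≤
            Real.exp (-(c₁ * u ^ 2)) := by
  intro θ hθ
  set M0 : ℝ := Real.exp (c + θ ^ 2 / (2 * A)) with hM0
  have hgi : Integrable (fun s : ℝ => M0 * Real.exp (-(A / 2) * s ^ 2)) :=
    (integrable_exp_neg_mul_sq (by positivity)).const_mul _
  have hle : ∀ h : ℝ, |h| ≤ θ → ∀ s : ℝ,
      Real.exp (-F s + h * s) ≤ M0 * Real.exp (-(A / 2) * s ^ 2) := by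
    intro h hh s
    rw [hM0, ← Real.exp_add, Real.exp_le_exp]
    have h1 : h ^ 2 ≤ θ ^ 2 := sq_le_sq' (abs_le.1 hh).1 (abs_le.1 hh).2
    have h2 : h * s ≤ A / 2 * s ^ 2 + h ^ 2 / (2 * A) := by
      have : A / 2 * s ^ 2 + h ^ 2 / (2 * A) - h * s = (A * s - h) ^ 2 / (2 * A) := by
        field_simp; ring
      have h3 : 0 ≤ (A * s - h) ^ 2 / (2 * A) := by positivity
      linarith
    have h3 : h ^ 2 / (2 * A) ≤ θ ^ 2 / (2 * A) := by gcongr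
    nlinarith [hF s]
  have hwi : ∀ h : ℝ, |h| ≤ θ → Integrable (fun s : ℝ => Real.exp (-F s + h * s)) := by
    intro h hh
    refine hgi.mono' (by fun_prop) (Filter.Eventually.of_forall fun s => ?_)
    rw [Real.norm_eq_abs, abs_of_pos (Real.exp_pos _)]
    exact hle h hh s
  have h0i : Integrable (fun s : ℝ => Real.exp (-F s)) := by
    simpa using hwi 0 (by simpa using hθ)
  obtain ⟨V, hV, hVle⟩ := aux_var (fun s => Real.exp (-F s)) (fun s => Real.exp_pos _) h0i
  set M : ℝ := ∫ s : ℝ, M0 * Real.exp (-(A / 2) * s ^ 2) with hM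
  have hZpos : ∀ h : ℝ, |h| ≤ θ → 0 < ∫ s : ℝ, Real.exp (-F s + h * s) :=
    fun h hh => integral_exp_pos (hwi h hh)
  have hZle : ∀ h : ℝ, |h| ≤ θ → ∫ s : ℝ, Real.exp (-F s + h * s) ≤ M :=
    fun h hh => integral_mono (hwi h hh) hgi (hle h hh)
  have hMpos : 0 < M := (hZpos 0 (by simpa using hθ)).trans_le (hZle 0 (by simpa using hθ))
  refine ⟨1, one_pos, Real.exp (-θ) / 25 * V / M, by positivity, fun h hh u hu => ?_⟩
  have hZ := hZpos h hh
  have hZM := hZle h hh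
  have hw := hwi h hh
  obtain ⟨a, ha, hP⟩ := aux_norm _ hw u
  have key : ∫ s, Complex.exp (Complex.I * u * s) ∂(nuTilt F h) =
      ((∫ s : ℝ, Real.exp (-F s + h * s))⁻¹ : ℝ) •
        ∫ s : ℝ, ((Real.exp (-F s + h * s) : ℝ) : ℂ) * Complex.exp (Complex.I * u * s) := by
    rw [nuTilt, integral_smul_measure, integral_withDensity_eq_integral_toReal_smul
      (by fun_prop) (by simp)]
    rw [ENNReal.toReal_inv, ENNReal.toReal_ofReal hZ.le]
    congr 1
    refine integral_congr_ae (Filter.Eventually.of_forall fun s => ?_)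
    simp only [ENNReal.toReal_ofReal (Real.exp_pos _).le, Complex.real_smul]
  rw [key, norm_smul, hP, Real.norm_eq_abs, abs_of_pos (inv_pos.2 hZ)]
  set Z := ∫ s : ℝ, Real.exp (-F s + h * s) with hZdef
  have hci : Integrable (fun s : ℝ => Real.exp (-F s + h * s) * Real.cos (u * s - a)) :=
    hw.mul_bdd (c := 1) (by fun_prop)
      (Filter.Eventually.of_forall fun s => by simpa using Real.abs_cos_le_one _)
  have hdi : Integrable (fun s : ℝ => Real.exp (-F s + h * s) * (1 - Real.cos (u * s - a))) := by
    refine (hw.sub hci).congr (Filter.Eventually.of_forall fun s => ?_)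
    simp only [Pi.sub_apply]; ring
  have hd : ∫ s : ℝ, Real.exp (-F s + h * s) * (1 - Real.cos (u * s - a))
      = Z - ∫ s : ℝ, Real.exp (-F s + h * s) * Real.cos (u * s - a) := by
    rw [hZdef, ← integral_sub hw hci]
    congr 1; ext s; ring
  have hlow : Real.exp (-θ) / 25 * (u ^ 2 * V) ≤
      ∫ s : ℝ, Real.exp (-F s + h * s) * (1 - Real.cos (u * s - a)) := by
    calc Real.exp (-θ) / 25 * (u ^ 2 * V)
        ≤ Real.exp (-θ) / 25 * ∫ s in Set.Icc (-1 : ℝ) 1, (u * s - a) ^ 2 * Real.exp (-F s) := by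
          gcongr; exact hVle u a
      _ = ∫ s in Set.Icc (-1 : ℝ) 1,
            Real.exp (-θ) / 25 * ((u * s - a) ^ 2 * Real.exp (-F s)) := by
          rw [integral_const_mul]
      _ ≤ ∫ s in Set.Icc (-1 : ℝ) 1, Real.exp (-F s + h * s) * (1 - Real.cos (u * s - a)) := by
          refine setIntegral_mono_on ?_ hdi.integrableOn measurableSet_Icc fun s hs => ?_
          · have hc : Continuous fun s : ℝ => (u * s - a) ^ 2 := by fun_prop
            exact (h0i.integrableOn.continuousOn_mul hc.continuousOn isCompact_Icc).const_mul _
          · have hs1 : |s| ≤ 1 := abs_le.2 hs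
            have b1 : |u * s - a| ≤ Real.pi + 1 := by
              have : |u * s| ≤ 1 := by
                rw [abs_mul]; exact mul_le_one₀ hu (abs_nonneg _) hs1
              linarith [abs_sub (u * s) a]
            have b2 := aux_cos b1
            have b3 : Real.exp (-θ) ≤ Real.exp (h * s) := by
              rw [Real.exp_le_exp]
              have : |h * s| ≤ θ := by
                rw [abs_mul]
                nlinarith [abs_nonneg h, abs_nonneg s]
              exact (abs_le.1 this).1
            rw [Real.exp_add]
            calc Real.exp (-θ) / 25 * ((u * s - a) ^ 2 * Real.exp (-F s))
                = Real.exp (-F s) * Real.exp (-θ) * ((u * s - a) ^ 2 / 25) := by ring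
              _ ≤ _ := by gcongr
      _ ≤ _ := by
          refine setIntegral_le_integral hdi (Filter.Eventually.of_forall fun s => ?_)
          exact mul_nonneg (Real.exp_pos _).le (by linarith [Real.cos_le_one (u * s - a)])
  set D := ∫ s : ℝ, Real.exp (-F s + h * s) * Real.cos (u * s - a)
  have hK : 0 ≤ Real.exp (-θ) / 25 * (u ^ 2 * V) := by positivity
  have h1 : Z⁻¹ * D ≤ 1 - Real.exp (-θ) / 25 * V / M * u ^ 2 := by
    have e1 : Z⁻¹ * D ≤ Z⁻¹ * (Z - Real.exp (-θ) / 25 * (u ^ 2 * V)) := by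
      gcongr; linarith
    have e2 : Real.exp (-θ) / 25 * (u ^ 2 * V) / M ≤ Real.exp (-θ) / 25 * (u ^ 2 * V) / Z := by
      gcongr
    have e3 : Z⁻¹ * (Z - Real.exp (-θ) / 25 * (u ^ 2 * V))
        = 1 - Real.exp (-θ) / 25 * (u ^ 2 * V) / Z := by field_simp
    have e4 : Real.exp (-θ) / 25 * V / M * u ^ 2 = Real.exp (-θ) / 25 * (u ^ 2 * V) / M := by ring
    linarith
  have h2 := Real.add_one_le_exp (-(Real.exp (-θ) / 25 * V / M * u ^ 2))
  linarith

end
end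

section
/- For every θ ≥ 0 and all reals 0 < δ < T there exists η > 0 such that for every h ∈ ℝ with |h| ≤ θ and every u ∈ ℝ with δ ≤ |u| ≤ T, one has | ∫_ℝ e^{i u s} ν_h(ds) | ≤ e^{−η}. -/
open MeasureTheory Filter Topology
open scoped ENNReal NNReal

noncomputable section

theorem tilt_bound {A c : ℝ} (hA : 0 < A) {F : ℝ → ℝ}
    (hF : ∀ s : ℝ, A * s ^ 2 - c ≤ F s) {θ h : ℝ} (hh : |h| ≤ θ) (s : ℝ) :
    Real.exp (-F s + h * s) ≤ Real.exp (c + θ ^ 2 / (2 * A)) * Real.exp (-(A / 2) * s ^ 2) := by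
  rw [← Real.exp_add]
  apply Real.exp_le_exp.mpr
  have h1 := hF s
  have h2 : h * s ≤ θ * |s| := by
    calc h * s ≤ |h * s| := le_abs_self _
      _ = |h| * |s| := abs_mul _ _
      _ ≤ _ := by gcongr
  have h3 : θ * |s| ≤ θ ^ 2 / (2 * A) + A / 2 * s ^ 2 := by
    have : θ ^ 2 / (2 * A) + A / 2 * s ^ 2 - θ * |s| = (θ - A * |s|) ^ 2 / (2 * A) := by
      rw [← sq_abs s]
      field_simp
      ring
    have h4 : 0 ≤ (θ - A * |s|) ^ 2 / (2 * A) := by positivity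
    linarith
  linarith

theorem tilt_dom_integrable {A c : ℝ} (hA : 0 < A) (θ : ℝ) :
    Integrable (fun s : ℝ => Real.exp (c + θ ^ 2 / (2 * A)) * Real.exp (-(A / 2) * s ^ 2)) :=
  (integrable_exp_neg_mul_sq (half_pos hA)).const_mul _

theorem tilt_integrable {A c : ℝ} (hA : 0 < A) {F : ℝ → ℝ} (hFmeas : Measurable F)
    (hF : ∀ s : ℝ, A * s ^ 2 - c ≤ F s) (h : ℝ) :
    Integrable (fun s : ℝ => Real.exp (-F s + h * s)) := by
  refine (tilt_dom_integrable (c := c) hA |h|).mono' (by fun_prop) (ae_of_all _ fun s => ?_)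
  rw [Real.norm_of_nonneg (Real.exp_nonneg _)]
  exact tilt_bound hA hF le_rfl s

theorem tilt_Z_pos {A c : ℝ} (hA : 0 < A) {F : ℝ → ℝ} (hFmeas : Measurable F)
    (hF : ∀ s : ℝ, A * s ^ 2 - c ≤ F s) (h : ℝ) :
    0 < ∫ s : ℝ, Real.exp (-F s + h * s) :=
  integral_exp_pos (tilt_integrable hA hFmeas hF h)

theorem tilt_prob {A c : ℝ} (hA : 0 < A) {F : ℝ → ℝ} (hFmeas : Measurable F)
    (hF : ∀ s : ℝ, A * s ^ 2 - c ≤ F s) (h : ℝ) :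
    IsProbabilityMeasure (nuTilt F h) := by
  constructor
  have hZ := tilt_Z_pos hA hFmeas hF h
  rw [nuTilt, Measure.smul_apply, withDensity_apply _ MeasurableSet.univ, Measure.restrict_univ,
    ← ofReal_integral_eq_lintegral_ofReal (tilt_integrable hA hFmeas hF h)
      (ae_of_all _ fun _ => Real.exp_nonneg _), smul_eq_mul]
  exact ENNReal.inv_mul_cancel (by simpa using hZ) ENNReal.ofReal_ne_top

theorem tilt_ac {F : ℝ → ℝ} (hFmeas : Measurable F) (h : ℝ) :
    (volume : Measure ℝ) ≪ nuTilt F h := by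
  have h1 : (volume : Measure ℝ) ≪
      volume.withDensity fun s => ENNReal.ofReal (Real.exp (-F s + h * s)) :=
    withDensity_absolutelyContinuous' (by fun_prop) (ae_of_all _ fun s => by
      simpa using Real.exp_pos _)
  refine h1.trans ?_
  exact Measure.absolutelyContinuous_smul (ENNReal.inv_ne_zero.mpr ENNReal.ofReal_ne_top)

theorem tilt_lt_one {A c : ℝ} (hA : 0 < A) {F : ℝ → ℝ} (hFmeas : Measurable F)
    (hF : ∀ s : ℝ, A * s ^ 2 - c ≤ F s) (h u : ℝ) (hu : u ≠ 0) :
    ‖∫ s, Complex.exp (Complex.I * u * s) ∂(nuTilt F h)‖ < 1 := by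
  have := tilt_prob hA hFmeas hF h
  have hle : ∀ᵐ s ∂(nuTilt F h), ‖Complex.exp (Complex.I * u * (s : ℝ))‖ ≤ 1 :=
    ae_of_all _ fun s => by simp [Complex.norm_exp]
  rcases ae_eq_const_or_norm_integral_lt_of_norm_le_const hle with h1 | h1
  · exfalso
    have h2 := (tilt_ac hFmeas h).ae_eq h1
    have h3 := (Continuous.ae_eq_iff_eq volume (by fun_prop) continuous_const).mp h2
    have h4 := congrFun h3 0
    have h5 := congrFun h3 (Real.pi / u)
    have h6 : Complex.I * u * ((Real.pi / u : ℝ) : ℂ) = Real.pi * Complex.I := by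
      have : (u : ℂ) ≠ 0 := by exact_mod_cast hu
      push_cast
      field_simp
    simp only [h6, Complex.exp_pi_mul_I] at h5
    simp only [Complex.ofReal_zero, mul_zero, Complex.exp_zero] at h4
    rw [← h5] at h4
    norm_num at h4
  · simpa using h1

theorem tilt_formula {F : ℝ → ℝ} (hFmeas : Measurable F) (h u : ℝ) :
    ∫ s, Complex.exp (Complex.I * u * s) ∂(nuTilt F h) =
      (∫ r : ℝ, Real.exp (-F r + h * r))⁻¹ •
        ∫ s : ℝ, Real.exp (-F s + h * s) • Complex.exp (Complex.I * u * s) := by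
  rw [nuTilt, integral_smul_measure, integral_withDensity_eq_integral_toReal_smul (by fun_prop)
    (ae_of_all _ fun _ => ENNReal.ofReal_lt_top)]
  simp only [ENNReal.toReal_inv, ENNReal.toReal_ofReal (Real.exp_nonneg _)]
  rw [ENNReal.toReal_ofReal (integral_nonneg fun _ => Real.exp_nonneg _)]

theorem tilt_contOn {A c : ℝ} (hA : 0 < A) {F : ℝ → ℝ} (hFmeas : Measurable F)
    (hF : ∀ s : ℝ, A * s ^ 2 - c ≤ F s) (θ : ℝ) :
    ContinuousOn (fun p : ℝ × ℝ => ‖∫ s, Complex.exp (Complex.I * p.2 * s) ∂(nuTilt F p.1)‖)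
      {p | |p.1| ≤ θ} := by
  simp only [tilt_formula hFmeas]
  have key : ContinuousOn (fun p : ℝ × ℝ => ∫ r : ℝ, Real.exp (-F r + p.1 * r))
      {p | |p.1| ≤ θ} := by
    refine continuousOn_of_dominated (fun p _ => by fun_prop) (fun p hp => ae_of_all _ fun s => ?_)
      (tilt_dom_integrable (c := c) hA θ) (ae_of_all _ fun s => by fun_prop)
    rw [Real.norm_of_nonneg (Real.exp_nonneg _)]
    exact tilt_bound hA hF hp s
  have key2 : ContinuousOn (fun p : ℝ × ℝ =>
      ∫ s : ℝ, Real.exp (-F s + p.1 * s) • Complex.exp (Complex.I * p.2 * s))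
      {p | |p.1| ≤ θ} := by
    refine continuousOn_of_dominated (fun p _ => by fun_prop) (fun p hp => ae_of_all _ fun s => ?_)
      (tilt_dom_integrable (c := c) hA θ) (ae_of_all _ fun s => by fun_prop)
    have : ‖Complex.exp (Complex.I * p.2 * s)‖ = 1 := by simp [Complex.norm_exp]
    rw [norm_smul, this, mul_one, Real.norm_of_nonneg (Real.exp_nonneg _)]
    exact tilt_bound hA hF hp s
  exact ((key.inv₀ fun p _ => (tilt_Z_pos hA hFmeas hF p.1).ne').smul key2).norm

/-- Medium-frequency bound for the tilted single-spin measures: for every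
`θ ≥ 0` and `0 < δ < T` there is `η > 0` such that for all `|h| ≤ θ` and `δ ≤ |u| ≤ T`,
`|∫ e^{ius} ν_h(ds)| ≤ e^{-η}`. -/
theorem tilted_medium_frequency_bound
    (A c : ℝ) (hA : 0 < A) (F : ℝ → ℝ) (hFmeas : Measurable F)
    (hF : ∀ s : ℝ, A * s ^ 2 - c ≤ F s) :
    ∀ θ : ℝ, 0 ≤ θ → ∀ δ T : ℝ, 0 < δ → δ < T →
      ∃ η : ℝ, 0 < η ∧
        ∀ h : ℝ, |h| ≤ θ → ∀ u : ℝ, δ ≤ |u| → |u| ≤ T →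
          ‖∫ s, Complex.exp (Complex.I * u * s) ∂(nuTilt F h)‖ ≤ Real.exp (-η) := by
  intro θ hθ δ T hδ hT
  let K : Set (ℝ × ℝ) := {p | |p.1| ≤ θ ∧ δ ≤ |p.2| ∧ |p.2| ≤ T}
  have hK : IsCompact K := by
    refine (isCompact_Icc (a := ((-θ, -T) : ℝ × ℝ)) (b := (θ, T))).of_isClosed_subset ?_ ?_
    · have c1 : IsClosed {p : ℝ × ℝ | |p.1| ≤ θ} := isClosed_le (by fun_prop) (by fun_prop)
      have c2 : IsClosed {p : ℝ × ℝ | δ ≤ |p.2|} := isClosed_le (by fun_prop) (by fun_prop)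
      have c3 : IsClosed {p : ℝ × ℝ | |p.2| ≤ T} := isClosed_le (by fun_prop) (by fun_prop)
      exact c1.inter (c2.inter c3)
    · rintro ⟨a, b⟩ ⟨h1, -, h3⟩
      have h1' := abs_le.mp h1
      have h3' := abs_le.mp h3
      exact ⟨⟨h1'.1, h3'.1⟩, ⟨h1'.2, h3'.2⟩⟩
  have hne : K.Nonempty := ⟨(0, δ), by simpa using hθ, by simp [abs_of_pos hδ],
    by simpa [abs_of_pos hδ] using hT.le⟩
  obtain ⟨p, hp, hmax⟩ := hK.exists_isMaxOn hne
    ((tilt_contOn hA hFmeas hF θ).mono fun p hp => hp.1)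
  have hp2 : p.2 ≠ 0 := abs_pos.mp (hδ.trans_le hp.2.1)
  have hlt := tilt_lt_one hA hFmeas hF p.1 p.2 hp2
  set m := ‖∫ s, Complex.exp (Complex.I * p.2 * s) ∂(nuTilt F p.1)‖ with hm
  have hM0 : 0 < max m (1 / 2) := lt_max_of_lt_right (by norm_num)
  refine ⟨-Real.log (max m (1 / 2)), ?_, fun h hh u hu1 hu2 => ?_⟩
  · have := Real.log_neg hM0 (max_lt hlt (by norm_num))
    linarith
  · rw [neg_neg, Real.exp_log hM0]
    have h1 := hmax (show (h, u) ∈ K from ⟨hh, hu1, hu2⟩)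
    exact le_trans h1 (le_max_left _ _)

end
end

section
/- Let ν be a Borel probability measure on ℝ and let π be a finite Borel measure on ℝ with π(A) ≤ ν(A) for every Borel set A. Then for all reals 0 < δ ≤ T and every u ∈ ℝ with δ ≤ |u| ≤ T, one has | ∫_ℝ e^{iux} ν(dx) |² ≤ 1 − 2 sin²(δ/T) · (π ⊗ π)( { (x,y) ∈ ℝ² : 2/T ≤ |x−y| ≤ π/T } ). -/
open MeasureTheory Filter Topology
open scoped ENNReal NNReal

noncomputable section

/-- Medium-frequency estimate: if `π ≤ ν` with `ν` a probability measure,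
then for `0 < δ ≤ T` and `δ ≤ |u| ≤ T`,
`|∫ e^{iux} ν(dx)|² ≤ 1 - 2 sin²(δ/T) (π⊗π){(x,y) : 2/T ≤ |x-y| ≤ π/T}`. -/
theorem charFn_sq_medium_frequency_bound
    (ν π' : Measure ℝ) [IsProbabilityMeasure ν] [IsFiniteMeasure π']
    (hle : π' ≤ ν)
    (δ T : ℝ) (hδ : 0 < δ) (hδT : δ ≤ T)
    (u : ℝ) (h1 : δ ≤ |u|) (h2 : |u| ≤ T) :
    ‖∫ x, Complex.exp (Complex.I * u * x) ∂ν‖ ^ 2 ≤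
      1 - 2 * Real.sin (δ / T) ^ 2 *
        ((π'.prod π')
          {p : ℝ × ℝ | 2 / T ≤ |p.1 - p.2| ∧ |p.1 - p.2| ≤ Real.pi / T}).toReal := by
  set S : Set (ℝ × ℝ) := {p : ℝ × ℝ | 2 / T ≤ |p.1 - p.2| ∧ |p.1 - p.2| ≤ Real.pi / T} with hS
  have hT : 0 < T := lt_of_lt_of_le hδ hδT
  have hSm : MeasurableSet S := by
    have a : IsClosed {p : ℝ × ℝ | 2 / T ≤ |p.1 - p.2|} :=
      isClosed_le (by fun_prop) (by fun_prop)
    have b : IsClosed {p : ℝ × ℝ | |p.1 - p.2| ≤ Real.pi / T} :=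
      isClosed_le (by fun_prop) (by fun_prop)
    exact a.measurableSet.inter b.measurableSet
  have hc : Integrable (fun x : ℝ => Real.cos (u * x)) ν :=
    Integrable.of_bound (C := 1) (by fun_prop)
      (Eventually.of_forall fun x => by simpa using Real.abs_cos_le_one (u * x))
  have hs : Integrable (fun x : ℝ => Real.sin (u * x)) ν :=
    Integrable.of_bound (C := 1) (by fun_prop)
      (Eventually.of_forall fun x => by simpa using Real.abs_sin_le_one (u * x))
  have hphi : ∫ x, Complex.exp (Complex.I * u * x) ∂ν =
      ((∫ x, Real.cos (u * x) ∂ν : ℝ) : ℂ) + ((∫ x, Real.sin (u * x) ∂ν : ℝ) : ℂ) * Complex.I := by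
    rw [← integral_complex_ofReal, ← integral_complex_ofReal, ← integral_mul_const, ← integral_add]
    · congr 1
      ext x
      rw [show Complex.I * u * x = ((u * x : ℝ) : ℂ) * Complex.I by push_cast; ring,
        Complex.exp_mul_I]
      simp
    · exact hc.ofReal
    · exact hs.ofReal.mul_const _
  have hcos : Integrable (fun p : ℝ × ℝ => Real.cos (u * p.1) * Real.cos (u * p.2)) (ν.prod ν) :=
    hc.mul_prod hc
  have hsin : Integrable (fun p : ℝ × ℝ => Real.sin (u * p.1) * Real.sin (u * p.2)) (ν.prod ν) :=
    hs.mul_prod hs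
  have hsq : ‖∫ x, Complex.exp (Complex.I * u * x) ∂ν‖ ^ 2 =
      ∫ p : ℝ × ℝ, (Real.cos (u * p.1) * Real.cos (u * p.2) +
        Real.sin (u * p.1) * Real.sin (u * p.2)) ∂(ν.prod ν) := by
    rw [hphi, Complex.sq_norm, Complex.normSq_add_mul_I, integral_add hcos hsin,
      integral_prod_mul (fun x => Real.cos (u * x)) (fun x => Real.cos (u * x)),
      integral_prod_mul (fun x => Real.sin (u * x)) (fun x => Real.sin (u * x))]
    ring
  have hind : Integrable (S.indicator fun _ => 2 * Real.sin (δ / T) ^ 2) (ν.prod ν) :=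
    (integrable_const _).indicator hSm
  have hpt : ∀ p : ℝ × ℝ, Real.cos (u * p.1) * Real.cos (u * p.2) +
        Real.sin (u * p.1) * Real.sin (u * p.2) ≤
      1 - S.indicator (fun _ => 2 * Real.sin (δ / T) ^ 2) p := by
    intro p
    rw [← Real.cos_sub]
    by_cases hp : p ∈ S
    · rw [Set.indicator_of_mem hp]
      obtain ⟨ha, hb⟩ := hp
      rw [div_le_iff₀ hT] at ha
      rw [le_div_iff₀ hT] at hb
      have e : Real.cos (u * p.1 - u * p.2) = Real.cos (2 * (|u| * |p.1 - p.2| / 2)) := by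
        rw [← mul_sub, ← Real.cos_abs, abs_mul]
        congr 1
        ring
      have hd : 0 ≤ |p.1 - p.2| := abs_nonneg _
      have l1 : δ / T ≤ |u| * |p.1 - p.2| / 2 := by
        rw [div_le_iff₀ hT]
        nlinarith
      have l2 : |u| * |p.1 - p.2| / 2 ≤ Real.pi / 2 := by nlinarith
      have l0 : 0 < δ / T := by positivity
      have l3 : Real.sin (δ / T) ≤ Real.sin (|u| * |p.1 - p.2| / 2) :=
        Real.sin_le_sin_of_le_of_le_pi_div_two (by linarith [Real.pi_pos]) l2 l1
      have l4 : 0 ≤ Real.sin (δ / T) :=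
        Real.sin_nonneg_of_nonneg_of_le_pi l0.le (by linarith [Real.pi_pos])
      have l5 := pow_le_pow_left₀ l4 l3 2
      rw [e, Real.cos_two_mul, Real.cos_sq']
      linarith
    · rw [Set.indicator_of_notMem hp]
      simpa using Real.cos_le_one _
  have hmeas : ((π'.prod π') S).toReal ≤ ((ν.prod ν) S).toReal :=
    ENNReal.toReal_mono (measure_ne_top _ _) (Measure.prod_mono hle hle S)
  rw [hsq]
  calc _ ≤ ∫ p : ℝ × ℝ, (1 - S.indicator (fun _ => 2 * Real.sin (δ / T) ^ 2) p) ∂(ν.prod ν) :=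
        integral_mono (hcos.add hsin) ((integrable_const _).sub hind) hpt
    _ = 1 - 2 * Real.sin (δ / T) ^ 2 * ((ν.prod ν) S).toReal := by
        rw [integral_sub (integrable_const _) hind, integral_indicator_const _ hSm]
        simp [Measure.real, mul_comm]
    _ ≤ _ := by
        have := mul_le_mul_of_nonneg_left hmeas (by positivity : 0 ≤ 2 * Real.sin (δ / T) ^ 2)
        linarith

end
end

section
/- Let G : ℝ → ℝ be differentiable, suppose e^{−G} and G′·e^{−G} are Lebesgue-integrable on ℝ, that e^{−G(x)} → 0 as x → +∞ and as x → −∞, and let ν be the Borel probability measure on ℝ with density e^{−G(x)} / ∫_ℝ e^{−G(r)} dr with respect to Lebesgue measure. Then for every real u ≠ 0, one has | ∫_ℝ e^{iux} ν(dx) | ≤ (1/|u|) ∫_ℝ |G′(x)| ν(dx). -/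
open MeasureTheory Filter Topology
open scoped ENNReal NNReal

noncomputable section

/-- The probability measure on `ℝ` with density `e^{-G(x)} / ∫ e^{-G(r)} dr` with respect
to Lebesgue measure. -/
def nuG (G : ℝ → ℝ) : Measure ℝ :=
  (ENNReal.ofReal (∫ r : ℝ, Real.exp (-G r)))⁻¹ •
    (volume.withDensity fun x => ENNReal.ofReal (Real.exp (-G x)))

/-- Integration-by-parts bound: if `G` is differentiable, `e^{-G}` and
`G'·e^{-G}` are integrable, and `e^{-G(x)} → 0` at `±∞`, then for every `u ≠ 0`,
`|∫ e^{iux} ν(dx)| ≤ (1/|u|) ∫ |G'(x)| ν(dx)` where `ν` has density proportional to `e^{-G}`. -/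
theorem charFn_integration_by_parts_bound
    (G : ℝ → ℝ) (hG : Differentiable ℝ G)
    (h1 : Integrable fun x => Real.exp (-G x))
    (h2 : Integrable fun x => deriv G x * Real.exp (-G x))
    (htop : Tendsto (fun x => Real.exp (-G x)) atTop (𝓝 0))
    (hbot : Tendsto (fun x => Real.exp (-G x)) atBot (𝓝 0)) :
    ∀ u : ℝ, u ≠ 0 →
      ‖∫ x, Complex.exp (Complex.I * u * x) ∂(nuG G)‖ ≤
        (1 / |u|) * ∫ x, |deriv G x| ∂(nuG G) := by
  intro u hu
  have hGm : Measurable fun x => ENNReal.ofReal (Real.exp (-G x)) := by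
    have := hG.continuous
    fun_prop
  have key1 : ∫ x, Complex.exp (Complex.I * u * x) ∂(volume.withDensity
      fun x => ENNReal.ofReal (Real.exp (-G x))) =
      ∫ x : ℝ, Complex.exp (Complex.I * u * x) * ((Real.exp (-G x) : ℝ) : ℂ) := by
    rw [integral_withDensity_eq_integral_toReal_smul hGm (by simp)]
    refine integral_congr_ae (Eventually.of_forall fun x => ?_)
    simp only [ENNReal.toReal_ofReal (Real.exp_pos _).le, Complex.real_smul]
    ring
  have key2 : ∫ x, |deriv G x| ∂(volume.withDensity
      fun x => ENNReal.ofReal (Real.exp (-G x))) =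
      ∫ x : ℝ, |deriv G x| * Real.exp (-G x) := by
    rw [integral_withDensity_eq_integral_toReal_smul hGm (by simp)]
    refine integral_congr_ae (Eventually.of_forall fun x => ?_)
    simp only [ENNReal.toReal_ofReal (Real.exp_pos _).le, smul_eq_mul]
    ring
  have hn : ∀ x : ℝ, ‖Complex.exp (Complex.I * u * x)‖ = 1 := by
    intro x
    have : Complex.I * u * x = ((u * x : ℝ) : ℂ) * Complex.I := by push_cast; ring
    rw [this, Complex.norm_exp_ofReal_mul_I]
  have hem : Continuous fun x : ℝ => Complex.exp (Complex.I * u * x) := by fun_prop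
  have hi : ∀ f : ℝ → ℝ, Integrable f →
      Integrable fun x : ℝ => Complex.exp (Complex.I * u * x) * ((f x : ℝ) : ℂ) := by
    intro f hf
    exact hf.ofReal.bdd_mul hem.aestronglyMeasurable
      (Eventually.of_forall fun x => (hn x).le)
  have hd1 : ∀ x : ℝ, HasDerivAt (fun x : ℝ => Complex.exp (Complex.I * u * x))
      (Complex.I * u * Complex.exp (Complex.I * u * x)) x := by
    intro x
    have h := ((Complex.ofRealCLM.hasDerivAt (x := x)).const_mul (Complex.I * u)).cexp
    simpa [mul_comm] using h
  have hd2 : ∀ x : ℝ, HasDerivAt (fun x : ℝ => ((Real.exp (-G x) : ℝ) : ℂ))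
      ((-(deriv G x * Real.exp (-G x)) : ℝ) : ℂ) x := by
    intro x
    have h := ((hG x).hasDerivAt.neg.exp).ofReal_comp
    have he : -(deriv G x * Real.exp (-G x)) = Real.exp (-G x) * -deriv G x := by ring
    rw [he]
    exact h
  have hibp := integral_mul_deriv_eq_deriv_mul_of_integrable
    (fun x _ => hd1 x) (fun x _ => hd2 x) (hi _ h2.neg)
    (by
      have := (hi _ h1).const_mul (Complex.I * u)
      refine this.congr (Eventually.of_forall fun x => ?_)
      simp only [Pi.mul_apply]
      ring) (hi _ h1)
  have hI : ∫ x : ℝ, Complex.I * u * Complex.exp (Complex.I * u * x) *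
      ((Real.exp (-G x) : ℝ) : ℂ) = Complex.I * u *
      ∫ x : ℝ, Complex.exp (Complex.I * u * x) * ((Real.exp (-G x) : ℝ) : ℂ) := by
    rw [← integral_const_mul]
    simp only [mul_assoc]
  rw [hI] at hibp
  have hbound : |u| * ‖∫ x : ℝ, Complex.exp (Complex.I * u * x) *
      ((Real.exp (-G x) : ℝ) : ℂ)‖ ≤ ∫ x : ℝ, |deriv G x| * Real.exp (-G x) := by
    have h := congrArg norm hibp
    rw [norm_neg, norm_mul, norm_mul, Complex.norm_I, one_mul, Complex.norm_real,
      Real.norm_eq_abs] at h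
    rw [← h]
    refine (norm_integral_le_integral_norm _).trans (le_of_eq ?_)
    refine integral_congr_ae (Eventually.of_forall fun x => ?_)
    simp only [norm_mul, hn, Complex.norm_real, Real.norm_eq_abs, abs_neg, abs_mul,
      Real.abs_exp, one_mul]
  have hup : 0 < |u| := abs_pos.mpr hu
  unfold nuG
  rw [integral_smul_measure, integral_smul_measure, key1, key2, norm_smul, smul_eq_mul,
    Real.norm_eq_abs, abs_of_nonneg ENNReal.toReal_nonneg, mul_left_comm]
  refine mul_le_mul_of_nonneg_left ?_ ENNReal.toReal_nonneg
  rw [one_div, le_inv_mul_iff₀ hup]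
  exact hbound

end
end

section
/- Let d ≥ 1, let J : ℤ^d × ℤ^d → ℝ be symmetric (J x y = J y x) with, for every x, the family (|J x y|)_{y∈ℤ^d} summable, and set K := sup_{x∈ℤ^d} ∑_{y∈ℤ^d} |J x y| < ∞. Let n ≥ 1 and let τ be a tree on the vertex set {0,1,…,n} (a connected acyclic simple graph on n+1 vertices). Then for every x₀ ∈ ℤ^d, the sum over all injective maps x : {0,1,…,n} → ℤ^d with x(0) = x₀ of ∏_{{i,j} ∈ E(τ)} |J x(i) x(j)| is at most K^n. -/
open Filter
open scoped ENNReal NNReal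

noncomputable section

/-- The lattice `ℤ^d`. -/
abbrev Zd (d : ℕ) := Fin d → ℤ

open Classical in
theorem tree_sum_aux {X : Type*} (w : Sym2 X → ℝ≥0∞) (K : ℝ≥0∞)
    (hK : ∀ x, ∑' y, w s(x, y) ≤ K) (x₀ : X) (m : ℕ) :
    ∀ (V : Type) [Fintype V] (G : SimpleGraph V) (_ : G.IsTree) (r : V)
      (_ : Fintype.card V = m + 1),
      ∑' f : V → X, (if f r = x₀ then ∏ e ∈ G.edgeFinset, w (e.map f) else 0) ≤ K ^ m := by
  induction m with
  | zero =>
    intro V _ G hG r hc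
    have hs : Subsingleton V := by
      rw [← Fintype.card_le_one_iff_subsingleton]; omega
    have he : G.edgeFinset = ∅ := by
      have := hG.card_edgeFinset
      rw [← Finset.card_eq_zero]; omega
    rw [tsum_eq_single (fun _ => x₀)]
    · simp [he]
    · intro f hf
      rw [if_neg]
      intro h
      apply hf
      funext a
      rw [← h, Subsingleton.elim a r]
  | succ m ih =>
    intro V _ G hG r hc
    have hnt : Nontrivial V := by
      rw [← Fintype.one_lt_card_iff_nontrivial]; omega
    obtain ⟨v, hvr, hdeg⟩ : ∃ v, v ≠ r ∧ G.degree v = 1 := by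
      obtain ⟨a, b, hab, ha, hb⟩ := hG.exists_ne_and_degree_eq_one
      by_cases h : a = r
      · exact ⟨b, fun hbr => hab (h.trans hbr.symm), by convert hb⟩
      · exact ⟨a, h, by convert ha⟩
    have hconn := hG.1.induce_compl_singleton_of_degree_eq_one hdeg
    obtain ⟨u, huv, hu⟩ := SimpleGraph.degree_eq_one_iff_existsUnique_adj.mp hdeg
    have huv' : u ≠ v := huv.ne'
    let G' : SimpleGraph {j // j ≠ v} := G.comap Subtype.val
    have hG' : G'.IsTree := ⟨hconn, hG.2.comap ⟨Subtype.val, fun h => h⟩ Subtype.val_injective⟩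
    have hcard : Fintype.card {j // j ≠ v} = m + 1 := by
      simp [Fintype.card_subtype_compl, hc]
    have hedge : G.edgeFinset =
        insert s(u, v) (G'.edgeFinset.image (Sym2.map Subtype.val)) := by
      ext e
      induction e using Sym2.ind with
      | _ a b =>
      simp only [SimpleGraph.mem_edgeFinset, SimpleGraph.mem_edgeSet, Finset.mem_insert,
        Finset.mem_image]
      constructor
      · intro hab
        by_cases ha : a = v
        · subst ha
          left
          rw [hu b hab]; exact Sym2.eq_swap
        by_cases hb : b = v
        · subst hb
          left
          rw [hu a hab.symm]
        · right
          exact ⟨s(⟨a, ha⟩, ⟨b, hb⟩), hab, rfl⟩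
      · rintro (h | ⟨e, he, h⟩)
        · rw [← SimpleGraph.mem_edgeSet, h]; exact huv.symm
        · induction e using Sym2.ind with
          | _ c d =>
          rw [← SimpleGraph.mem_edgeSet, ← h]
          exact he
    have hnot : s(u, v) ∉ G'.edgeFinset.image (Sym2.map Subtype.val) := by
      simp only [Finset.mem_image, not_exists, not_and]
      intro e _ h
      have : v ∈ Sym2.map Subtype.val e := by rw [h]; simp
      rw [Sym2.mem_map] at this
      obtain ⟨a, _, ha⟩ := this
      exact a.2 ha
    rw [← (Equiv.funSplitAt v X).symm.tsum_eq, ENNReal.tsum_prod', ENNReal.tsum_comm]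
    have key : ∀ (g : {j // j ≠ v} → X) (y : X),
        (if (Equiv.funSplitAt v X).symm (y, g) r = x₀ then
          ∏ e ∈ G.edgeFinset, w (e.map ((Equiv.funSplitAt v X).symm (y, g))) else 0) =
        (if g ⟨r, hvr.symm⟩ = x₀ then ∏ e ∈ G'.edgeFinset, w (e.map g) else 0)
          * w s(g ⟨u, huv'⟩, y) := by
      intro g y
      have h1 : ∀ a : {j // j ≠ v}, (Equiv.funSplitAt v X).symm (y, g) a.1 = g a := by
        intro a; simp [Equiv.funSplitAt, Equiv.piSplitAt, a.2]
      have h2 : (Equiv.funSplitAt v X).symm (y, g) v = y := by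
        simp [Equiv.funSplitAt, Equiv.piSplitAt]
      have h3 := h1 ⟨r, hvr.symm⟩
      have h4 := h1 ⟨u, huv'⟩
      simp only at h3 h4
      rw [h3]
      split_ifs
      · rw [hedge, Finset.prod_insert hnot, Finset.prod_image
          ((Sym2.map.injective Subtype.val_injective).injOn), mul_comm, Sym2.map_mk]
        congr 1
        · refine Finset.prod_congr rfl fun e _ => ?_
          rw [Sym2.map_map]
          congr 2
          funext a
          exact h1 a
        · simp [h4, h2]
      · simp
    simp_rw [key, ENNReal.tsum_mul_left]
    calc _ ≤ ∑' g : {j // j ≠ v} → X, (if g ⟨r, hvr.symm⟩ = x₀ then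
              ∏ e ∈ G'.edgeFinset, w (e.map g) else 0) * K :=
          ENNReal.tsum_le_tsum fun g => mul_le_mul_right (hK _) _
      _ ≤ K ^ m * K := by
          rw [ENNReal.tsum_mul_right]
          exact mul_le_mul_left (ih _ G' hG' _ hcard) _
      _ = K ^ (m + 1) := (pow_succ _ _).symm

/-- Tree-sum bound: for a tree `τ` on `{0,…,n}` and `x₀ ∈ ℤ^d`, the sum
over injective maps `x : {0,…,n} → ℤ^d` with `x 0 = x₀` of `∏_{{i,j}∈E(τ)} |J (x i) (x j)|`
is at most `K^n`, where `K = sup_x ∑_y |J x y|`. -/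
theorem tree_sum_bound
    (d : ℕ) (hd : 1 ≤ d)
    (J : Zd d → Zd d → ℝ)
    (hsym : ∀ a b, J a b = J b a)
    (hsum : ∀ x, Summable fun y => |J x y|)
    (hbdd : BddAbove (Set.range fun x => ∑' y, |J x y|))
    (n : ℕ) (hn : 1 ≤ n)
    (τ : SimpleGraph (Fin (n + 1))) [DecidableRel τ.Adj] (hτ : τ.IsTree)
    (x₀ : Zd d) :
    ∑' f : {f : Fin (n + 1) → Zd d // Function.Injective f ∧ f 0 = x₀},
        ∏ e ∈ τ.edgeFinset,
          ENNReal.ofReal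
            (Sym2.lift
              ⟨fun i j => |J (f.1 i) (f.1 j)|, fun i j => by show |J (f.1 i) (f.1 j)| = |J (f.1 j) (f.1 i)|; rw [hsym (f.1 i) (f.1 j)]⟩ e)
      ≤ ENNReal.ofReal ((⨆ x : Zd d, ∑' y, |J x y|) ^ n) := by
  classical
  let w : Sym2 (Zd d) → ℝ≥0∞ := Sym2.lift
    ⟨fun a b => ENNReal.ofReal |J a b|, fun a b => by simp only [hsym a b]⟩
  have hK : ∀ x, ∑' y, w s(x, y) ≤ ENNReal.ofReal (⨆ x : Zd d, ∑' y, |J x y|) := by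
    intro x
    change ∑' y, ENNReal.ofReal |J x y| ≤ _
    rw [← ENNReal.ofReal_tsum_of_nonneg (fun _ => abs_nonneg _) (hsum x)]
    exact ENNReal.ofReal_le_ofReal (le_ciSup hbdd x)
  have hK0 : 0 ≤ ⨆ x : Zd d, ∑' y, |J x y| :=
    Real.iSup_nonneg fun x => tsum_nonneg fun y => abs_nonneg _
  rw [ENNReal.ofReal_pow hK0]
  have main := tree_sum_aux w _ hK x₀ n (Fin (n + 1)) τ hτ 0 (by simp)
  refine le_trans (le_of_eq ?_) ((ENNReal.tsum_comp_le_tsum_of_injective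
    (f := (Subtype.val : {f : Fin (n + 1) → Zd d // Function.Injective f ∧ f 0 = x₀} → _))
    Subtype.val_injective _).trans main)
  refine tsum_congr fun f => ?_
  rw [if_pos f.2.2]
  refine Finset.prod_congr (by ext e; simp) fun e _ => ?_
  induction e using Sym2.ind with
  | _ a b => rfl

end
end

section
/- For every integer n ≥ 1, the sum over all edge sets E ⊆ {unordered pairs of distinct elements of {1,…,n}} such that the simple graph with vertex set {1,…,n} and edge set E is connected, of (−1)^{|E|}, equals (−1)^{n−1} (n−1)!. -/
open Filter
open scoped Classical

noncomputable section

/-- The set of non-diagonal pairs that are monochromatic for `f`. -/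
def monoPairs {n q : ℕ} (f : Fin n → Fin q) : Finset (Sym2 (Fin n)) :=
  Finset.univ.filter (fun e => ¬ e.IsDiag ∧ (e.map f).IsDiag)

/-- The graph of an edge set. -/
def gr {n : ℕ} (E : Finset (Sym2 (Fin n))) : SimpleGraph (Fin n) :=
  SimpleGraph.fromEdgeSet (↑E : Set (Sym2 (Fin n)))

/-- All loopless edge sets. -/
def edgeSets (n : ℕ) : Finset (Finset (Sym2 (Fin n))) :=
  Finset.univ.filter (fun E => ∀ e ∈ E, ¬ e.IsDiag)

lemma monoPairs_eq_empty {n q : ℕ} (f : Fin n → Fin q) :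
    monoPairs f = ∅ ↔ Function.Injective f := by
  rw [monoPairs, Finset.filter_eq_empty_iff]
  constructor
  · intro h a b hab
    by_contra hne
    exact h (Finset.mem_univ s(a, b)) ⟨by simpa using hne, by simpa using hab⟩
  · intro h e _ he
    induction e with
    | _ a b =>
      simp only [Sym2.map_mk, Sym2.mk_isDiag_iff] at he
      exact he.1 (h he.2)

lemma subset_mono_iff {n q : ℕ} (E : Finset (Sym2 (Fin n))) (hE : ∀ e ∈ E, ¬ e.IsDiag)
    (f : Fin n → Fin q) :
    E ⊆ monoPairs f ↔ ∀ a b, (gr E).Adj a b → f a = f b := by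
  constructor
  · intro h a b hab
    have h1 : s(a, b) ∈ E := by
      have := (SimpleGraph.fromEdgeSet_adj _).1 hab
      exact_mod_cast this.1
    have := h h1
    simp only [monoPairs, Finset.mem_filter, Sym2.map_mk, Sym2.mk_isDiag_iff] at this
    exact this.2.2
  · intro h e he
    have hd := hE e he
    induction e with
    | _ a b =>
      simp only [monoPairs, Finset.mem_filter, Sym2.map_mk, Sym2.mk_isDiag_iff] at hd ⊢
      refine ⟨Finset.mem_univ _, hd, h a b ?_⟩
      exact (SimpleGraph.fromEdgeSet_adj _).2 ⟨by exact_mod_cast he, hd⟩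

/-- Colourings constant along edges are colourings of components. -/
def compEquiv {n q : ℕ} (G : SimpleGraph (Fin n)) :
    {f : Fin n → Fin q // ∀ a b, G.Adj a b → f a = f b} ≃ (G.ConnectedComponent → Fin q) where
  toFun f := fun c => SimpleGraph.ConnectedComponent.lift f.1 (by
    intro v w p _
    induction p with
    | nil => rfl
    | cons h p ih => 
      rename_i hp
      exact (f.2 _ _ h).trans (ih hp.of_cons)) c
  invFun g := ⟨fun v => g (G.connectedComponentMk v), fun a b h => by
    exact congrArg g (SimpleGraph.ConnectedComponent.sound h.reachable)⟩
  left_inv f := by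
    ext v
    rfl
  right_inv g := by
    funext c
    induction c using SimpleGraph.ConnectedComponent.ind with
    | _ v => rfl

lemma card_subset_mono {n : ℕ} (q : ℕ) (E : Finset (Sym2 (Fin n))) (hE : ∀ e ∈ E, ¬ e.IsDiag) :
    (Finset.univ.filter (fun f : Fin n → Fin q => E ⊆ monoPairs f)).card
      = q ^ Nat.card (gr E).ConnectedComponent := by
  rw [← Fintype.card_subtype, Nat.card_eq_fintype_card,
    Fintype.card_congr ((Equiv.subtypeEquivRight (subset_mono_iff E hE)).trans (compEquiv (gr E)))]
  simp

lemma sum_pow_comp (n q : ℕ) :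
    ∑ E ∈ edgeSets n, (-1 : ℤ) ^ E.card * (q : ℤ) ^ Nat.card (gr E).ConnectedComponent
      = (q.descFactorial n : ℕ) := by
  have h1 : ∀ E ∈ edgeSets n,
      (-1 : ℤ) ^ E.card * (q : ℤ) ^ Nat.card (gr E).ConnectedComponent
      = ∑ f : Fin n → Fin q, if E ⊆ monoPairs f then (-1 : ℤ) ^ E.card else 0 := by
    intro E hE
    have hE' : ∀ e ∈ E, ¬ e.IsDiag := (Finset.mem_filter.1 hE).2
    rw [← Finset.sum_filter, Finset.sum_const, card_subset_mono q E hE', nsmul_eq_mul, mul_comm]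
    push_cast
    rfl
  rw [Finset.sum_congr rfl h1, Finset.sum_comm]
  have h2 : ∀ f : Fin n → Fin q,
      (∑ E ∈ edgeSets n, if E ⊆ monoPairs f then (-1 : ℤ) ^ E.card else 0)
        = if Function.Injective f then 1 else 0 := by
    intro f
    rw [← Finset.sum_filter]
    have : (edgeSets n).filter (fun E => E ⊆ monoPairs f) = (monoPairs f).powerset := by
      ext E
      simp only [edgeSets, Finset.mem_filter, Finset.mem_powerset, Finset.mem_univ, true_and,
        and_iff_right_iff_imp]
      intro h e he
      exact (Finset.mem_filter.1 (h he)).2.1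
    rw [this, Finset.sum_powerset_neg_one_pow_card]
    simp only [monoPairs_eq_empty]
  rw [Finset.sum_congr rfl (fun f _ => h2 f), Finset.sum_boole, ← Fintype.card_subtype,
    Fintype.card_congr (Equiv.subtypeInjectiveEquivEmbedding (Fin n) (Fin q)),
    Fintype.card_embedding_eq]
  simp

open Polynomial in
lemma poly_eq (n : ℕ) :
    ∑ E ∈ edgeSets n, C ((-1 : ℤ) ^ E.card) * X ^ Nat.card (gr E).ConnectedComponent
      = descPochhammer ℤ n := by
  apply Polynomial.eq_of_infinite_eval_eq
  apply Set.Infinite.mono _ (Set.infinite_range_of_injective (Nat.cast_injective (R := ℤ)))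
  rintro _ ⟨q, rfl⟩
  simp only [Set.mem_setOf_eq]
  rw [descPochhammer_eval_eq_descFactorial, ← sum_pow_comp, Polynomial.eval_finset_sum]
  simp

lemma eval_neg_one (n : ℕ) : (descPochhammer ℤ n).eval (-1) = (-1) ^ n * n.factorial := by
  induction n with
  | zero => simp
  | succ n ih =>
    rw [descPochhammer_succ_eval, ih, Nat.factorial_succ]
    push_cast
    ring

lemma conn_iff {n : ℕ} (hn : 1 ≤ n) (G : SimpleGraph (Fin n)) :
    G.Connected ↔ 1 = Nat.card G.ConnectedComponent := by
  haveI : Nonempty (Fin n) := ⟨⟨0, hn⟩⟩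
  rw [eq_comm, Nat.card_eq_one_iff_unique]
  constructor
  · intro h
    exact ⟨h.preconnected.subsingleton_connectedComponent, inferInstance⟩
  · rintro ⟨h, _⟩
    exact ⟨fun a b => SimpleGraph.ConnectedComponent.exact (Subsingleton.elim _ _)⟩

/-- The signed count of connected spanning subgraphs of the complete graph
on `n` vertices: `∑_{E connected} (-1)^{|E|} = (-1)^{n-1} (n-1)!`. -/
theorem signed_connected_graph_count (n : ℕ) (hn : 1 ≤ n) :
    ∑ E ∈ Finset.univ.filter
        (fun E : Finset (Sym2 (Fin n)) =>
          (∀ e ∈ E, ¬e.IsDiag) ∧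
            (SimpleGraph.fromEdgeSet (↑E : Set (Sym2 (Fin n)))).Connected),
      (-1 : ℤ) ^ E.card
      = (-1) ^ (n - 1) * (n - 1).factorial := by
  have h := congrArg (fun p => Polynomial.coeff p 1) (poly_eq n)
  simp only [Polynomial.finset_sum_coeff, Polynomial.coeff_C_mul, Polynomial.coeff_X_pow,
    mul_ite, mul_one, mul_zero] at h
  rw [← Finset.sum_filter, edgeSets, Finset.filter_filter] at h
  have hR : (descPochhammer ℤ n).coeff 1 = (-1) ^ (n - 1) * (n - 1).factorial := by
    obtain ⟨m, rfl⟩ : ∃ m, n = m + 1 := ⟨n - 1, by omega⟩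
    rw [descPochhammer_succ_left, Polynomial.coeff_X_mul, Polynomial.coeff_zero_eq_eval_zero,
      Polynomial.eval_comp]
    simpa using eval_neg_one m
  rw [← hR, ← h]
  apply Finset.sum_congr _ (fun _ _ => rfl)
  ext E
  simp only [Finset.mem_filter]
  rw [← conn_iff hn]
  rfl

end
end

section
/- Let 𝔾 be a finite connected simple graph with vertex set V, let 𝒞 be the set of connected spanning subgraphs of 𝔾 (subgraphs with vertex set V whose edge set is contained in E(𝔾) and which are connected), and let 𝒯 ⊆ 𝒞 be the set of spanning trees of 𝔾. Let R : 𝒯 → 𝒞 satisfy (i) E(τ) ⊆ E(R(τ)) for every τ ∈ 𝒯, and (ii) for every g ∈ 𝒞 there is exactly one τ ∈ 𝒯 with E(τ) ⊆ E(g) ⊆ E(R(τ)). Then for every function w from E(𝔾) to ℂ, ∑_{g∈𝒞} ∏_{e∈E(g)} (w(e) − 1) = ∑_{τ∈𝒯} ∏_{e∈E(τ)} (w(e) − 1) · ∏_{e∈E(R(τ))∖E(τ)} w(e). -/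
open scoped Classical

noncomputable section

/-- Tree-graph identity for a partition scheme: if `R` maps each spanning
tree `τ` of a finite connected graph `𝔾` to a connected spanning subgraph `R(τ)` with
`E(τ) ⊆ E(R(τ))` and the intervals `[τ, R(τ)]` partition the connected spanning subgraphs,
then `∑_{g} ∏_{e∈E(g)} (w e - 1) = ∑_τ ∏_{e∈E(τ)} (w e - 1) ∏_{e∈E(R(τ))∖E(τ)} w e`. -/
theorem partition_scheme_identity
    {V : Type*} [Fintype V] [DecidableEq V]
    (G : SimpleGraph V) (hG : G.Connected)
    (R : {E : Finset (Sym2 V) // ↑E ⊆ G.edgeSet ∧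
            (SimpleGraph.fromEdgeSet (↑E : Set (Sym2 V))).IsTree} →
         {E : Finset (Sym2 V) // ↑E ⊆ G.edgeSet ∧
            (SimpleGraph.fromEdgeSet (↑E : Set (Sym2 V))).Connected})
    (hR1 : ∀ τ, τ.1 ⊆ (R τ).1)
    (hR2 : ∀ g : {E : Finset (Sym2 V) // ↑E ⊆ G.edgeSet ∧
            (SimpleGraph.fromEdgeSet (↑E : Set (Sym2 V))).Connected},
        ∃! τ, τ.1 ⊆ g.1 ∧ g.1 ⊆ (R τ).1)
    (w : Sym2 V → ℂ) :
    ∑ g : {E : Finset (Sym2 V) // ↑E ⊆ G.edgeSet ∧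
            (SimpleGraph.fromEdgeSet (↑E : Set (Sym2 V))).Connected},
        ∏ e ∈ g.1, (w e - 1)
      = ∑ τ : {E : Finset (Sym2 V) // ↑E ⊆ G.edgeSet ∧
            (SimpleGraph.fromEdgeSet (↑E : Set (Sym2 V))).IsTree},
          (∏ e ∈ τ.1, (w e - 1)) * ∏ e ∈ (R τ).1 \ τ.1, w e := by
  choose T hT hTu using hR2
  have hiff : ∀ g τ, T g = τ ↔ (τ.1 ⊆ g.1 ∧ g.1 ⊆ (R τ).1) := by
    intro g τ
    constructor
    · rintro rfl
      exact hT g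
    · intro h
      exact (hTu g τ h).symm
  rw [← Finset.sum_fiberwise (s := Finset.univ) (g := T)]
  refine Finset.sum_congr rfl fun τ _ => ?_
  have h1 : ∏ e ∈ (R τ).1 \ τ.1, w e
      = ∑ S ∈ ((R τ).1 \ τ.1).powerset, ∏ e ∈ S, (w e - 1) := by
    rw [← Finset.prod_add_one]
    simp
  rw [h1, Finset.mul_sum]
  refine Finset.sum_bij (fun g _ => g.1 \ τ.1) ?_ ?_ ?_ ?_
  · intro g hg
    rw [Finset.mem_filter, hiff] at hg
    exact Finset.mem_powerset.2 (Finset.sdiff_subset_sdiff hg.2.2 subset_rfl)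
  · intro g hg g' hg' h
    rw [Finset.mem_filter, hiff] at hg hg'
    apply Subtype.ext
    rw [← Finset.union_sdiff_of_subset hg.2.1, ← Finset.union_sdiff_of_subset hg'.2.1]
    exact congrArg (τ.1 ∪ ·) h
  · intro S hS
    rw [Finset.mem_powerset, Finset.subset_sdiff] at hS
    have hsub : τ.1 ∪ S ⊆ (R τ).1 := Finset.union_subset (hR1 τ) hS.1
    refine ⟨⟨τ.1 ∪ S, (Finset.coe_subset.2 hsub).trans (R τ).2.1, ?_⟩, ?_, ?_⟩
    · exact τ.2.2.connected.mono (SimpleGraph.fromEdgeSet_mono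
        (Finset.coe_subset.2 Finset.subset_union_left))
    · rw [Finset.mem_filter, hiff]
      exact ⟨Finset.mem_univ _, Finset.subset_union_left, hsub⟩
    · exact Finset.union_sdiff_cancel_left hS.2.symm
  · intro g hg
    rw [Finset.mem_filter, hiff] at hg
    rw [mul_comm, Finset.prod_sdiff hg.2.1]

end
end
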